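/- Fix 1 ≤ n < N and a constant unitary U ∈ U(N). Let Z : M^{1+m} → M(N−n,n;ℂ) be smooth and P := U P_0(Z) U†. Then P satisfies the equations of motion [P, □P] = 0 of the nonlinear Grassmann sigma model if and only if Z satisfies ∂^μ∂_μ Z − 2 ∂^μZ (I + Z†Z)^{-1} Z† ∂_μZ = 0. -/

import Mathlib

/-!
`(1+m)`-dimensional Minkowski space `M^{1+m}` is modeled as `Fin (m+1) → ℝ` with
coordinates `x 0, x 1, ..., x m` and metric `η = diag(1, -1, ..., -1)`.
`pd μ f` is the partial derivative `∂_μ f`, `pdM` its entrywise matrix version,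
`boxS`/`boxM` the d'Alembertian `□ = ∂_0² - Σ_{k=1}^m ∂_k²`, and contractions over a
repeated index `μ` are written as `∑ μ, eta μ * ⋯` (resp. `eta μ • ⋯`).
-/

noncomputable section
open Matrix
open scoped Kronecker

/-- `(1+m)`-dimensional Minkowski spacetime. -/
abbrev Spacetime (m : ℕ) := Fin (m + 1) → ℝ

/-- Partial derivative `∂_μ`. -/
def pd {m : ℕ} {E : Type*} [NormedAddCommGroup E] [NormedSpace ℝ E]
    (μ : Fin (m + 1)) (f : Spacetime m → E) : Spacetime m → E :=
  fun x => fderiv ℝ f x (Pi.single μ 1)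

/-- Entrywise partial derivative `∂_μ` of a matrix-valued function. -/
def pdM {m : ℕ} {ι κ : Type*} (μ : Fin (m + 1)) (P : Spacetime m → Matrix ι κ ℂ) :
    Spacetime m → Matrix ι κ ℂ :=
  fun x => Matrix.of fun i j => pd μ (fun y => P y i j) x

/-- The Minkowski signature `η = diag(1, -1, …, -1)` as a complex scalar:
raising an index costs `eta μ`. -/
def eta {m : ℕ} (μ : Fin (m + 1)) : ℂ := if μ = 0 then 1 else -1

/-- d'Alembertian `□ = ∂^μ∂_μ` on scalar functions. -/
def boxS {m : ℕ} (f : Spacetime m → ℂ) : Spacetime m → ℂ :=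
  fun x => ∑ μ, eta μ * pd μ (pd μ f) x

/-- d'Alembertian `□ = ∂^μ∂_μ` on matrix-valued functions. -/
def boxM {m : ℕ} {ι κ : Type*} (P : Spacetime m → Matrix ι κ ℂ) :
    Spacetime m → Matrix ι κ ℂ :=
  fun x => ∑ μ, eta μ • pdM μ (pdM μ P) x

/-- The block matrix `V(Z) = [[I, -Z†],[Z, I]]` on `ℂ^n ⊕ ℂ^p`. -/
def Vmat {n p : ℕ} (Z : Matrix (Fin p) (Fin n) ℂ) :
    Matrix (Fin n ⊕ Fin p) (Fin n ⊕ Fin p) ℂ :=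
  Matrix.fromBlocks 1 (-Zᴴ) Z 1

/-- The block matrix `W(Z) = [[I, Z†],[-Z, I]]` on `ℂ^n ⊕ ℂ^p`. -/
def Wmat {n p : ℕ} (Z : Matrix (Fin p) (Fin n) ℂ) :
    Matrix (Fin n ⊕ Fin p) (Fin n ⊕ Fin p) ℂ :=
  Matrix.fromBlocks 1 Zᴴ (-Z) 1

/-- The projector `P₀(Z) = V(Z) · diag(I_n, 0_p) · V(Z)⁻¹`. -/
def P0 {n p : ℕ} (Z : Matrix (Fin p) (Fin n) ℂ) :
    Matrix (Fin n ⊕ Fin p) (Fin n ⊕ Fin p) ℂ :=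
  Vmat Z * Matrix.fromBlocks 1 0 0 0 * (Vmat Z)⁻¹

/-- Entrywise smoothness. -/
def Sm {m : ℕ} {ι κ : Type*} (A : Spacetime m → Matrix ι κ ℂ) : Prop :=
  ∀ i j, ContDiff ℝ (⊤ : ℕ∞) fun x => A x i j

section helpers
variable {m : ℕ} {ι κ l : Type*}

lemma Sm.diff {A : Spacetime m → Matrix ι κ ℂ} (h : Sm A) (i : ι) (j : κ) (x : Spacetime m) :
    DifferentiableAt ℝ (fun x => A x i j) x :=
  ((h i j).differentiable (by simp)) x

lemma Sm.pdM {A : Spacetime m → Matrix ι κ ℂ} (h : Sm A) (μ : Fin (m + 1)) : Sm (pdM μ A) := by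
  intro i j
  have h1 : ContDiff ℝ (⊤ : ℕ∞) (fderiv ℝ (fun y => A y i j)) :=
    (h i j).fderiv_right (by simp)
  exact h1.clm_apply contDiff_const

lemma Sm.const (C : Matrix ι κ ℂ) : Sm (fun _ : Spacetime m => C) :=
  fun _ _ => contDiff_const

lemma Sm.mul [Fintype κ] {A : Spacetime m → Matrix ι κ ℂ} {B : Spacetime m → Matrix κ l ℂ}
    (hA : Sm A) (hB : Sm B) : Sm (fun x => A x * B x) := by
  intro i j
  simp only [Matrix.mul_apply]
  exact ContDiff.sum fun k _ => (hA i k).mul (hB k j)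

lemma Sm.add {A B : Spacetime m → Matrix ι κ ℂ} (hA : Sm A) (hB : Sm B) :
    Sm (fun x => A x + B x) := fun i j => (hA i j).add (hB i j)

lemma Sm.neg {A : Spacetime m → Matrix ι κ ℂ} (hA : Sm A) :
    Sm (fun x => - A x) := fun i j => (hA i j).neg

lemma Sm.conjTranspose {A : Spacetime m → Matrix ι κ ℂ} (hA : Sm A) :
    Sm (fun x => (A x)ᴴ) := fun i j => (starL' ℝ (A := ℂ)).contDiff.comp (hA j i)

lemma Sm.det [Fintype ι] [DecidableEq ι] {A : Spacetime m → Matrix ι ι ℂ} (hA : Sm A) :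
    ContDiff ℝ (⊤ : ℕ∞) fun x => (A x).det := by
  simp only [Matrix.det_apply]
  refine ContDiff.sum fun σ _ => ?_
  refine ContDiff.const_smul _ ?_
  exact contDiff_prod fun i _ => hA _ _

lemma Sm.inv [Fintype ι] [DecidableEq ι] {A : Spacetime m → Matrix ι ι ℂ} (hA : Sm A)
    (hu : ∀ x, IsUnit (A x)) : Sm (fun x => (A x)⁻¹) := by
  intro i j
  have h1 : ∀ x, (A x).det ≠ 0 := fun x => ((Matrix.isUnit_iff_isUnit_det _).1 (hu x)).ne_zero
  simp only [Matrix.inv_def, Matrix.smul_apply, Ring.inverse_eq_inv', Matrix.adjugate_apply,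
    smul_eq_mul]
  refine (hA.det.inv h1).mul ?_
  apply Sm.det (A := fun x => (A x).updateRow j (Pi.single i 1))
  intro a b
  by_cases h : a = j
  · subst h
    simp only [Matrix.updateRow_self]
    exact contDiff_const
  · simp only [Matrix.updateRow_ne h]
    exact hA a b

lemma Sm.fromRows {A : Spacetime m → Matrix ι κ ℂ} {B : Spacetime m → Matrix l κ ℂ}
    (hA : Sm A) (hB : Sm B) : Sm (fun x => Matrix.fromRows (A x) (B x)) := by
  rintro (i | i) j
  · exact hA i j
  · exact hB i j

lemma Sm.fromCols {A : Spacetime m → Matrix κ ι ℂ} {B : Spacetime m → Matrix κ l ℂ}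
    (hA : Sm A) (hB : Sm B) : Sm (fun x => Matrix.fromCols (A x) (B x)) := by
  rintro i (j | j)
  · exact hA i j
  · exact hB i j

lemma pdM_const (μ : Fin (m + 1)) (C : Matrix ι κ ℂ) : pdM μ (fun _ => C) = 0 := by
  ext x i j
  simp [_root_.pdM, pd]

lemma pdM_mul [Fintype κ] (μ : Fin (m + 1)) {A : Spacetime m → Matrix ι κ ℂ}
    {B : Spacetime m → Matrix κ l ℂ} (hA : Sm A) (hB : Sm B) :
    pdM μ (fun x => A x * B x) = fun x => pdM μ A x * B x + A x * pdM μ B x := by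
  ext x i j
  simp only [_root_.pdM, pd, Matrix.of_apply, Matrix.mul_apply, Matrix.add_apply]
  rw [fderiv_fun_sum fun k _ => (hA.diff i k x).fun_mul (hB.diff k j x)]
  rw [_root_.sum_apply, ← Finset.sum_add_distrib]
  refine Finset.sum_congr rfl fun k _ => ?_
  rw [fderiv_fun_mul (hA.diff i k x) (hB.diff k j x)]
  simp
  ring

lemma pdM_add (μ : Fin (m + 1)) {A B : Spacetime m → Matrix ι κ ℂ}
    (hA : Sm A) (hB : Sm B) :
    pdM μ (fun x => A x + B x) = fun x => pdM μ A x + pdM μ B x := by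
  ext x i j
  simp only [_root_.pdM, pd, Matrix.of_apply, Matrix.add_apply]
  rw [fderiv_fun_add (hA.diff i j x) (hB.diff i j x)]
  simp

lemma pdM_neg (μ : Fin (m + 1)) (A : Spacetime m → Matrix ι κ ℂ) :
    pdM μ (fun x => - A x) = fun x => - pdM μ A x := by
  ext x i j
  simp [_root_.pdM, pd]

lemma pdM_conjTranspose (μ : Fin (m + 1)) (A : Spacetime m → Matrix ι κ ℂ) :
    pdM μ (fun x => (A x)ᴴ) = fun x => (pdM μ A x)ᴴ := by
  ext x i j
  simp only [_root_.pdM, pd, Matrix.of_apply, Matrix.conjTranspose_apply]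
  rw [fderiv_star]
  simp

lemma pdM_fromRows (μ : Fin (m + 1)) (A : Spacetime m → Matrix ι κ ℂ)
    (B : Spacetime m → Matrix l κ ℂ) : pdM μ (fun x => Matrix.fromRows (A x) (B x)) =
      fun x => Matrix.fromRows (pdM μ A x) (pdM μ B x) := by
  ext x (i | i) j <;> rfl

lemma pdM_fromCols (μ : Fin (m + 1)) (A : Spacetime m → Matrix κ ι ℂ)
    (B : Spacetime m → Matrix κ l ℂ) : pdM μ (fun x => Matrix.fromCols (A x) (B x)) =
      fun x => Matrix.fromCols (pdM μ A x) (pdM μ B x) := by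
  ext x i (j | j) <;> rfl

lemma pdM2_mul [Fintype κ] (μ : Fin (m + 1)) {A : Spacetime m → Matrix ι κ ℂ}
    {B : Spacetime m → Matrix κ l ℂ} (hA : Sm A) (hB : Sm B) (x : Spacetime m) :
    pdM μ (pdM μ (fun x => A x * B x)) x =
      pdM μ (pdM μ A) x * B x + (2 : ℂ) • (pdM μ A x * pdM μ B x) + A x * pdM μ (pdM μ B) x := by
  rw [pdM_mul μ hA hB, pdM_add μ ((hA.pdM μ).mul hB) (hA.mul (hB.pdM μ)),
    pdM_mul μ (hA.pdM μ) hB, pdM_mul μ hA (hB.pdM μ), two_smul]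
  simp only [add_assoc]

lemma boxM_mul [Fintype κ] {A : Spacetime m → Matrix ι κ ℂ}
    {B : Spacetime m → Matrix κ l ℂ} (hA : Sm A) (hB : Sm B) (x : Spacetime m) :
    boxM (fun x => A x * B x) x =
      boxM A x * B x + (2 : ℂ) • ∑ μ, eta μ • (pdM μ A x * pdM μ B x) + A x * boxM B x := by
  simp only [boxM, pdM2_mul _ hA hB, smul_add, Finset.sum_add_distrib, Matrix.sum_mul,
    Matrix.mul_sum, Matrix.smul_mul, Matrix.mul_smul, Finset.smul_sum]
  congr 2
  exact Finset.sum_congr rfl fun μ _ => smul_comm _ _ _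

lemma boxM_const (C : Matrix ι κ ℂ) (x : Spacetime m) : boxM (fun _ => C) x = 0 := by
  have : ∀ μ : Fin (m + 1), pdM μ (0 : Spacetime m → Matrix ι κ ℂ) = 0 :=
    fun μ => pdM_const μ 0
  simp [boxM, pdM_const, this]

lemma boxM_conjTranspose (A : Spacetime m → Matrix ι κ ℂ) (x : Spacetime m) :
    boxM (fun x => (A x)ᴴ) x = (boxM A x)ᴴ := by
  simp only [boxM, pdM_conjTranspose, Matrix.conjTranspose_sum, Matrix.conjTranspose_smul]
  refine Finset.sum_congr rfl fun μ _ => ?_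
  congr 1
  unfold eta
  split_ifs <;> simp

lemma boxM_fromRows (A : Spacetime m → Matrix ι κ ℂ)
    (B : Spacetime m → Matrix l κ ℂ) (x : Spacetime m) :
    boxM (fun x => Matrix.fromRows (A x) (B x)) x =
      Matrix.fromRows (boxM A x) (boxM B x) := by
  ext (i | i) j <;> simp [boxM, pdM_fromRows, Matrix.sum_apply]

end helpers

section blocks
variable {n p : ℕ} (Z : Matrix (Fin p) (Fin n) ℂ)

open scoped ComplexOrder in
lemma isUnit_M : IsUnit (1 + Zᴴ * Z) :=
  (Matrix.PosDef.one.add_posSemidef (Matrix.posSemidef_conjTranspose_mul_self Z)).isUnit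

open scoped ComplexOrder in
lemma isUnit_M' : IsUnit (1 + Z * Zᴴ) :=
  (Matrix.PosDef.one.add_posSemidef (Matrix.posSemidef_self_mul_conjTranspose Z)).isUnit

lemma W_mul_V : Wmat Z * Vmat Z = Matrix.fromBlocks (1 + Zᴴ * Z) 0 0 (1 + Z * Zᴴ) := by
  simp [Wmat, Vmat, Matrix.fromBlocks_multiply, add_comm]

lemma isUnit_dets : IsUnit (Wmat Z).det ∧ IsUnit (Vmat Z).det := by
  rw [← IsUnit.mul_iff, ← Matrix.det_mul, W_mul_V, Matrix.det_fromBlocks_zero₂₁, IsUnit.mul_iff]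
  exact ⟨(Matrix.isUnit_iff_isUnit_det _).1 (isUnit_M Z),
    (Matrix.isUnit_iff_isUnit_det _).1 (isUnit_M' Z)⟩

lemma W_eq : Wmat Z = Matrix.fromRows (Matrix.fromCols (1 : Matrix (Fin n) (Fin n) ℂ) Zᴴ) (Matrix.fromCols (-Z) (1 : Matrix (Fin p) (Fin p) ℂ)) := by
  ext (i | i) (j | j) <;> rfl

lemma V_eq : Vmat Z = Matrix.fromCols (Matrix.fromRows (1 : Matrix (Fin n) (Fin n) ℂ) Z) (Matrix.fromRows (-Zᴴ) (1 : Matrix (Fin p) (Fin p) ℂ)) := by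
  ext (i | i) (j | j) <;> rfl

lemma P0_eq : P0 Z = Matrix.fromRows (1 : Matrix (Fin n) (Fin n) ℂ) Z * (1 + Zᴴ * Z)⁻¹ * Matrix.fromCols (1 : Matrix (Fin n) (Fin n) ℂ) Zᴴ := by
  have hM := (Matrix.isUnit_iff_isUnit_det _).1 (isUnit_M Z)
  have key : (Matrix.fromRows (1 : Matrix (Fin n) (Fin n) ℂ) Z * (1 + Zᴴ * Z)⁻¹ * Matrix.fromCols (1 : Matrix (Fin n) (Fin n) ℂ) Zᴴ) * Vmat Z
      = Vmat Z * Matrix.fromBlocks 1 0 0 0 := by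
    rw [V_eq, Matrix.mul_assoc _ (Matrix.fromCols (1 : Matrix (Fin n) (Fin n) ℂ) Zᴴ), Matrix.mul_fromCols,
      Matrix.fromCols_mul_fromRows, Matrix.fromCols_mul_fromRows, ← V_eq]
    simp only [Matrix.one_mul, Matrix.mul_one, neg_add_cancel, Matrix.mul_fromCols,
      Matrix.mul_assoc, Matrix.nonsing_inv_mul _ hM, Matrix.mul_zero]
    ext (i | i) (j | j) <;> simp [Vmat, Matrix.fromBlocks_multiply]
  rw [P0, ← key, Matrix.mul_assoc, Matrix.mul_nonsing_inv _ (isUnit_dets Z).2, Matrix.mul_one]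

lemma P0_herm : (P0 Z)ᴴ = P0 Z := by
  rw [P0_eq, Matrix.conjTranspose_mul, Matrix.conjTranspose_mul]
  simp [-Matrix.fromRows_mul, Matrix.conjTranspose_nonsing_inv, Matrix.mul_assoc,
    Matrix.conjTranspose_fromCols_eq_fromRows_conjTranspose,
    Matrix.conjTranspose_fromRows_eq_fromCols_conjTranspose]

lemma P0_F : P0 Z * Matrix.fromRows (1 : Matrix (Fin n) (Fin n) ℂ) Z = Matrix.fromRows (1 : Matrix (Fin n) (Fin n) ℂ) Z := by
  have hM := (Matrix.isUnit_iff_isUnit_det _).1 (isUnit_M Z)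
  rw [P0_eq, Matrix.mul_assoc, Matrix.fromCols_mul_fromRows, Matrix.mul_assoc]
  simp [Matrix.nonsing_inv_mul _ hM]

lemma P0_G : P0 Z * Matrix.fromRows (-Zᴴ) (1 : Matrix (Fin p) (Fin p) ℂ) = 0 := by
  rw [P0_eq, Matrix.mul_assoc, Matrix.fromCols_mul_fromRows]
  simp

lemma G_P0 : Matrix.fromCols (-Z) (1 : Matrix (Fin p) (Fin p) ℂ) * P0 Z = 0 := by
  rw [P0_eq, ← Matrix.mul_assoc, ← Matrix.mul_assoc, Matrix.fromCols_mul_fromRows]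
  simp

lemma F_P0 : Matrix.fromCols (1 : Matrix (Fin n) (Fin n) ℂ) Zᴴ * P0 Z = Matrix.fromCols (1 : Matrix (Fin n) (Fin n) ℂ) Zᴴ := by
  have hM := (Matrix.isUnit_iff_isUnit_det _).1 (isUnit_M Z)
  rw [P0_eq, ← Matrix.mul_assoc, ← Matrix.mul_assoc, Matrix.fromCols_mul_fromRows]
  simp [Matrix.mul_nonsing_inv _ hM]

/-- The commutator with the projector is controlled by one off-diagonal block. -/
lemma comm_iff (B : Matrix (Fin n ⊕ Fin p) (Fin n ⊕ Fin p) ℂ) (hB : Bᴴ = B) :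
    P0 Z * B - B * P0 Z = 0 ↔
      Matrix.fromCols (-Z) (1 : Matrix (Fin p) (Fin p) ℂ) * B * Matrix.fromRows (1 : Matrix (Fin n) (Fin n) ℂ) Z = 0 := by
  have hGF : Matrix.fromCols (-Z) (1 : Matrix (Fin p) (Fin p) ℂ) * (P0 Z * B - B * P0 Z) * Matrix.fromRows (1 : Matrix (Fin n) (Fin n) ℂ) Z
      = - (Matrix.fromCols (-Z) (1 : Matrix (Fin p) (Fin p) ℂ) * B * Matrix.fromRows (1 : Matrix (Fin n) (Fin n) ℂ) Z) := by
    rw [Matrix.mul_sub, Matrix.sub_mul, ← Matrix.mul_assoc, G_P0, Matrix.zero_mul,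
      Matrix.zero_mul, zero_sub, Matrix.mul_assoc, Matrix.mul_assoc, P0_F, ← Matrix.mul_assoc]
  constructor
  · intro h
    rw [h] at hGF
    simpa using hGF.symm
  · intro h
    have h' : Matrix.fromCols (1 : Matrix (Fin n) (Fin n) ℂ) Zᴴ * B * Matrix.fromRows (-Zᴴ) (1 : Matrix (Fin p) (Fin p) ℂ) = 0 := by
      have := congrArg Matrix.conjTranspose h
      simpa [Matrix.conjTranspose_mul, hB, Matrix.mul_assoc,
        Matrix.conjTranspose_fromCols_eq_fromRows_conjTranspose,
        Matrix.conjTranspose_fromRows_eq_fromCols_conjTranspose] using this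
    have hW : Wmat Z * (P0 Z * B - B * P0 Z) * Vmat Z = 0 := by
      have e : Wmat Z * (P0 Z * B - B * P0 Z) * Vmat Z
        = (Wmat Z * P0 Z) * B * Vmat Z - Wmat Z * B * (P0 Z * Vmat Z) := by
        simp only [Matrix.mul_sub, Matrix.sub_mul, Matrix.mul_assoc]
      rw [e, W_eq, V_eq, Matrix.fromRows_mul, Matrix.mul_fromCols (P0 Z), F_P0, G_P0, P0_F, P0_G]
      simp only [Matrix.fromRows_mul, Matrix.mul_fromCols, Matrix.zero_mul, Matrix.mul_zero, h, h']
      ext (i | i) (j | j) <;> simp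
    have h1 := (isUnit_dets Z).1
    have h2 := (isUnit_dets Z).2
    calc P0 Z * B - B * P0 Z
        = (Wmat Z)⁻¹ * (Wmat Z * (P0 Z * B - B * P0 Z) * Vmat Z) * (Vmat Z)⁻¹ := by
          rw [Matrix.mul_assoc (Wmat Z), Matrix.nonsing_inv_mul_cancel_left _ _ h1,
            Matrix.mul_nonsing_inv_cancel_right _ _ h2]
      _ = 0 := by rw [hW]; simp

end blocks

lemma Sm_P0 {m n p : ℕ} {Z : Spacetime m → Matrix (Fin p) (Fin n) ℂ} (hZ : Sm Z) :
    Sm (fun x => P0 (Z x)) := by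
  simp only [P0_eq]
  exact (((Sm.const 1).fromRows hZ).mul
    (((Sm.const 1).add (hZ.conjTranspose.mul hZ)).inv fun x => isUnit_M (Z x))).mul
    ((Sm.const 1).fromCols hZ.conjTranspose)

lemma box_block {m n p : ℕ} {Z : Spacetime m → Matrix (Fin p) (Fin n) ℂ} (hZ : Sm Z)
    (x : Spacetime m) :
    Matrix.fromCols (-Z x) (1 : Matrix (Fin p) (Fin p) ℂ) * boxM (fun y => P0 (Z y)) x * Matrix.fromRows (1 : Matrix (Fin n) (Fin n) ℂ) (Z x) =
      boxM Z x - (2 : ℂ) • ∑ μ, eta μ •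
              (pdM μ Z x * (1 + (Z x)ᴴ * Z x)⁻¹ * (Z x)ᴴ * pdM μ Z x) := by
  have hQ := Sm_P0 hZ
  have hF : Sm (fun y => Matrix.fromRows (1 : Matrix (Fin n) (Fin n) ℂ) (Z y)) :=
    (Sm.const 1).fromRows hZ
  have hG : Sm (fun y => Matrix.fromCols (-Z y) (1 : Matrix (Fin p) (Fin p) ℂ)) :=
    hZ.neg.fromCols (Sm.const 1)
  have e1 := boxM_mul hQ hF x
  simp only [P0_F] at e1
  have e2 : ∀ μ, Matrix.fromCols (-Z x) (1 : Matrix (Fin p) (Fin p) ℂ) * pdM μ (fun y => P0 (Z y)) x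
      = Matrix.fromCols (pdM μ Z x) (0 : Matrix (Fin p) (Fin p) ℂ) * P0 (Z x) := by
    intro μ
    have := congrFun (pdM_mul μ hG hQ) x
    simp only [G_P0, pdM_const, pdM_fromCols, pdM_neg] at this
    have h3 := eq_neg_of_add_eq_zero_right this.symm
    rw [h3, ← Matrix.neg_mul]
    congr 1
    ext i (j | j) <;> simp
  have e3 : ∀ μ, Matrix.fromCols (-Z x) (1 : Matrix (Fin p) (Fin p) ℂ) *
        (pdM μ (fun y => P0 (Z y)) x * Matrix.fromRows (0 : Matrix (Fin n) (Fin n) ℂ) (pdM μ Z x))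
      = pdM μ Z x * (1 + (Z x)ᴴ * Z x)⁻¹ * (Z x)ᴴ * pdM μ Z x := by
    intro μ
    rw [← Matrix.mul_assoc, e2, P0_eq]
    simp only [← Matrix.mul_assoc, Matrix.fromCols_mul_fromRows]
    simp only [Matrix.mul_assoc, Matrix.fromCols_mul_fromRows]
    simp
  have e4 := congrArg (fun T => Matrix.fromCols (-Z x) (1 : Matrix (Fin p) (Fin p) ℂ) * T) e1
  simp only [pdM_fromRows, boxM_fromRows, boxM_const, pdM_const, Matrix.mul_add, Matrix.mul_smul,
    Matrix.mul_sum, Pi.zero_apply, e3, Matrix.fromCols_mul_fromRows, ← Matrix.mul_assoc, G_P0,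
    Matrix.zero_mul, Matrix.mul_zero, add_zero, zero_add, Matrix.one_mul] at e4
  rw [e4]
  simp

/-- For `P = U P₀(Z) U†` with `U` a constant unitary and `Z` smooth,
the equations of motion `[P, □P] = 0` hold iff
`∂^μ∂_μZ - 2 ∂^μZ (I + Z†Z)⁻¹ Z† ∂_μZ = 0`. -/
theorem statement7 {m n p : ℕ} (hn : 0 < n) (hp : 0 < p)
    (U : Matrix (Fin n ⊕ Fin p) (Fin n ⊕ Fin p) ℂ)
    (hU : U ∈ Matrix.unitaryGroup (Fin n ⊕ Fin p) ℂ)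
    (Z : Spacetime m → Matrix (Fin p) (Fin n) ℂ)
    (hZ : ∀ i j, ContDiff ℝ (⊤ : ℕ∞) fun x => Z x i j)
    (P : Spacetime m → Matrix (Fin n ⊕ Fin p) (Fin n ⊕ Fin p) ℂ)
    (hP : ∀ x, P x = U * P0 (Z x) * Uᴴ) :
    (∀ x, P x * boxM P x - boxM P x * P x = 0)
      ↔ (∀ x, boxM Z x
          - (2 : ℂ) • ∑ μ, eta μ •
              (pdM μ Z x * (1 + (Z x)ᴴ * Z x)⁻¹ * (Z x)ᴴ * pdM μ Z x) = 0) := by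
  have hS : Sm Z := hZ
  have hQ := Sm_P0 hS
  have hU1 : Uᴴ * U = 1 := by
    have := (Matrix.mem_unitaryGroup_iff').1 hU
    simpa [Matrix.star_eq_conjTranspose] using this
  have hP' : P = fun x => U * P0 (Z x) * Uᴴ := funext hP
  have hbox : ∀ x, boxM P x = U * boxM (fun y => P0 (Z y)) x * Uᴴ := by
    intro x
    rw [hP', boxM_mul ((Sm.const U).mul hQ) (Sm.const Uᴴ), boxM_mul (Sm.const U) hQ]
    simp [boxM_const, pdM_const]
  refine forall_congr' fun x => ?_
  rw [← box_block hS x, ← comm_iff (Z x) _ (by rw [← boxM_conjTranspose]; simp only [P0_herm]),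
    hbox, hP]
  have hc : ∀ A B : Matrix (Fin n ⊕ Fin p) (Fin n ⊕ Fin p) ℂ,
      U * A * Uᴴ * (U * B * Uᴴ) = U * (A * B) * Uᴴ := by
    intro A B
    calc U * A * Uᴴ * (U * B * Uᴴ) = U * A * (Uᴴ * U) * B * Uᴴ := by
          simp only [Matrix.mul_assoc]
      _ = _ := by rw [hU1]; simp only [Matrix.mul_assoc, Matrix.one_mul]
  rw [hc, hc, ← Matrix.sub_mul, ← Matrix.mul_sub]
  constructor
  · intro h
    have := congrArg (fun T => Uᴴ * T * U) h
    simp only [Matrix.mul_zero, Matrix.zero_mul] at this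
    rw [← this]
    simp only [← Matrix.mul_assoc, hU1, Matrix.one_mul]
    rw [Matrix.mul_assoc _ Uᴴ U, hU1, Matrix.mul_one]
  · intro h
    rw [h]
    simp
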